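/- arXiv:2410.08949 — 11 statements merged into one kernel-verified Lean document; each statement's English description precedes it below -/
import Mathlib

section
/- Let Ω be a finite set and m : Finset Ω → ℝ with m(F) ≥ 0 for every F ⊆ Ω, and define Bel(F) = Σ_{∅ ≠ G ⊆ F} m(G). Then Bel is completely monotone: for every k ≥ 1 and every family F₁, …, F_k of subsets of Ω, Bel(F₁ ∪ ⋯ ∪ F_k) ≥ Σ_{∅ ≠ I ⊆ {1,…,k}} (−1)^{|I|+1} · Bel(⋂_{i ∈ I} F_i). -/
open Finset

/-- The belief function of `m`: `Bel(F) = Σ_{∅ ≠ G ⊆ F} m(G)`. -/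
def belief {Ω : Type*} [Fintype Ω] [DecidableEq Ω] (m : Finset Ω → ℝ)
    (F : Finset Ω) : ℝ :=
  ∑ G ∈ F.powerset.filter (fun G => G ≠ ∅), m G

/-- The nonempty subsets common to all the `F i` are the nonempty subsets of their intersection. -/
theorem inf_powerset_filter_ne_empty {ι Ω : Type*} [Fintype Ω] [DecidableEq Ω]
    (t : Finset ι) (ht : t.Nonempty) (F : ι → Finset Ω) :
    t.inf' ht (fun i => (F i).powerset.filter (fun G => G ≠ ∅)) =
      (t.inf F).powerset.filter (fun G => G ≠ ∅) := by
  ext G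
  obtain ⟨i, hi⟩ := id ht
  rw [← Finset.singleton_subset_iff, Finset.le_inf'_iff]
  simp only [Finset.singleton_subset_iff, Finset.mem_filter, Finset.mem_powerset,
    Finset.le_inf_iff]
  exact ⟨fun h => ⟨fun j hj => (h j hj).1, (h i hi).2⟩, fun h j hj => ⟨h.1 j hj, h.2⟩⟩

/-- Inclusion-exclusion for the union of the families of nonempty subsets of the `F i`. -/
theorem sum_biUnion_powerset_eq_sum_belief {ι Ω : Type*} [Fintype ι] [DecidableEq ι] [Fintype Ω]
    [DecidableEq Ω] (m : Finset Ω → ℝ) (F : ι → Finset Ω) :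
    ∑ G ∈ Finset.univ.biUnion (fun i => (F i).powerset.filter (fun G => G ≠ ∅)), m G =
      ∑ I ∈ (Finset.univ : Finset (Finset ι)).filter (fun I => I ≠ ∅),
        (-1 : ℝ) ^ (I.card + 1) * belief m (I.inf F) := by
  rw [Finset.inclusion_exclusion_sum_biUnion]
  simp only [inf_powerset_filter_ne_empty]
  rw [Finset.sum_coe_sort (Finset.univ.powerset.filter (·.Nonempty))
    (fun I => (-1 : ℤ) ^ (I.card + 1) • ∑ G ∈ (I.inf F).powerset.filter (fun G => G ≠ ∅), m G)]
  simp [belief, Finset.nonempty_iff_ne_empty]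

/-- A belief function built from a nonnegative mass function is completely monotone. -/
theorem belief_completely_monotone {Ω : Type*} [Fintype Ω] [DecidableEq Ω]
    (m : Finset Ω → ℝ) (hm : ∀ F : Finset Ω, 0 ≤ m F)
    (k : ℕ) (hk : 1 ≤ k) (F : Fin k → Finset Ω) :
    ∑ I ∈ (Finset.univ : Finset (Finset (Fin k))).filter (fun I => I ≠ ∅),
        (-1 : ℝ) ^ (I.card + 1) * belief m (I.inf F)
      ≤ belief m (Finset.univ.sup F) := by
  rw [← sum_biUnion_powerset_eq_sum_belief, belief]
  refine Finset.sum_le_sum_of_subset_of_nonneg ?_ fun G _ _ => hm G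
  intro G hG
  simp only [Finset.mem_biUnion, Finset.mem_filter, Finset.mem_powerset] at hG ⊢
  obtain ⟨i, hi, hGi, hG0⟩ := hG
  exact ⟨hGi.trans (Finset.le_sup (f := F) hi), hG0⟩
end

section
/- Let Ω be a finite set and m₁, m₂ : Finset Ω → ℝ, and let m₁⊓m₂ be their conjunctive combination, (m₁⊓m₂)(F) = Σ_{A, B ⊆ Ω, A ∩ B = F} m₁(A)·m₂(B). Then the commonality function of m₁⊓m₂ is the pointwise product of the commonality functions: for every F ⊆ Ω, q_{m₁⊓m₂}(F) = q_{m₁}(F) · q_{m₂}(F). -/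
open Finset

/-- The commonality function of `m`: `q(F) = Σ_{G ⊆ Ω, F ⊆ G} m(G)`. -/
def commonality {Ω : Type*} [Fintype Ω] [DecidableEq Ω] (m : Finset Ω → ℝ)
    (F : Finset Ω) : ℝ :=
  ∑ G ∈ Finset.univ.filter (fun G : Finset Ω => F ⊆ G), m G

/-- The conjunctive combination rule: `(m₁⊓m₂)(F) = Σ_{A ∩ B = F} m₁(A)·m₂(B)`. -/
def ccr {Ω : Type*} [Fintype Ω] [DecidableEq Ω] (m₁ m₂ : Finset Ω → ℝ)
    (F : Finset Ω) : ℝ :=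
  ∑ p ∈ Finset.univ.filter (fun p : Finset Ω × Finset Ω => p.1 ∩ p.2 = F),
    m₁ p.1 * m₂ p.2

theorem commonality_ccr {Ω : Type*} [Fintype Ω] [DecidableEq Ω]
    (m₁ m₂ : Finset Ω → ℝ) :
    ∀ F : Finset Ω, commonality (ccr m₁ m₂) F = commonality m₁ F * commonality m₂ F := by
  intro F
  simp only [commonality, ccr]
  rw [Finset.sum_mul_sum, ← Finset.sum_product']
  rw [← Finset.sum_fiberwise_of_maps_to (t := Finset.univ.filter (fun G : Finset Ω => F ⊆ G))
    (g := fun p : Finset Ω × Finset Ω => p.1 ∩ p.2)]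
  · refine Finset.sum_congr rfl fun G hG => Finset.sum_congr ?_ fun _ _ => rfl
    ext ⟨A, B⟩
    simp only [mem_filter, mem_univ, true_and, mem_product] at hG ⊢
    exact ⟨fun h => ⟨subset_inter_iff.mp (h ▸ hG), h⟩, And.right⟩
  · intro p hp
    simp only [mem_filter, mem_univ, true_and, mem_product] at hp ⊢
    exact subset_inter_iff.mpr hp
end

section
/- Let Ω be a finite set and m₁, m₂ : Finset Ω → ℝ, and let m₁⊔m₂ be their disjunctive combination, (m₁⊔m₂)(F) = Σ_{A, B ⊆ Ω, A ∪ B = F} m₁(A)·m₂(B). Then the implicability function of m₁⊔m₂ is the pointwise product of the implicability functions: for every F ⊆ Ω, b_{m₁⊔m₂}(F) = b_{m₁}(F) · b_{m₂}(F). -/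
open Finset

/-- The implicability function of `m`: `b(F) = Σ_{G ⊆ F} m(G)`. -/
def implicability {Ω : Type*} [Fintype Ω] [DecidableEq Ω] (m : Finset Ω → ℝ)
    (F : Finset Ω) : ℝ :=
  ∑ G ∈ F.powerset, m G

/-- The disjunctive combination rule: `(m₁⊔m₂)(F) = Σ_{A ∪ B = F} m₁(A)·m₂(B)`. -/
def dcr {Ω : Type*} [Fintype Ω] [DecidableEq Ω] (m₁ m₂ : Finset Ω → ℝ)
    (F : Finset Ω) : ℝ :=
  ∑ p ∈ Finset.univ.filter (fun p : Finset Ω × Finset Ω => p.1 ∪ p.2 = F),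
    m₁ p.1 * m₂ p.2

theorem implicability_dcr {Ω : Type*} [Fintype Ω] [DecidableEq Ω]
    (m₁ m₂ : Finset Ω → ℝ) :
    ∀ F : Finset Ω, implicability (dcr m₁ m₂) F = implicability m₁ F * implicability m₂ F := by
  intro F
  have h : univ.filter (fun p : Finset Ω × Finset Ω => p.1 ∪ p.2 ∈ F.powerset) =
      F.powerset ×ˢ F.powerset := by
    ext p
    simp [union_subset_iff]
  simp only [implicability, dcr]
  rw [sum_fiberwise_eq_sum_filter, h, sum_mul_sum, sum_product]
end

section
/- Let n ≥ 1 and π : Fin n → ℝ with 0 < π(i) ≤ 1 for all i, and set θ(i) = 2·arctan(√((1 − π(i))/π(i))). Let R_Y(θ) be the 2×2 real matrix with rows (cos(θ/2), sin(θ/2)) and (−sin(θ/2), cos(θ/2)), and define the n-fold Kronecker product U : Matrix (Fin n → Fin 2) (Fin n → Fin 2) ℝ by U(x, y) = ∏_{i} R_Y(θ(i))(x(i), y(i)). Then the column of U corresponding to the all-ones index has squared entries equal to the poss-transferable mass function: for every x : Fin n → Fin 2, (U(x, 𝟙))² = ∏_{i : x(i) = 1} π(i) · ∏_{i : x(i)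 = 0} (1 − π(i)), where 𝟙 is the constant-1 index. (This is the statement that n RY gates with parameters determined by the contour function prepare the quantum state of the poss-transferable mass function.) -/
open Finset

/-- The single-qubit rotation gate `R_Y(θ)` (real form). -/
noncomputable def RY (θ : ℝ) : Matrix (Fin 2) (Fin 2) ℝ :=
  !![Real.cos (θ / 2), Real.sin (θ / 2); -Real.sin (θ / 2), Real.cos (θ / 2)]

/-- The squared cosine of `arctan √((1 - p) / p)` is `p`. -/
theorem cos_sq_arctan_sqrt_one_sub_div {p : ℝ} (hp : 0 < p) (hp1 : p ≤ 1) :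
    Real.cos (Real.arctan (Real.sqrt ((1 - p) / p))) ^ 2 = p := by
  rw [Real.cos_sq_arctan, Real.sq_sqrt (div_nonneg (sub_nonneg.2 hp1) hp.le)]
  field_simp
  ring

/-- The squared entries of the second column of `RY (2 * arctan √((1 - p) / p))`. -/
theorem RY_two_mul_arctan_apply_one_sq {p : ℝ} (hp : 0 < p) (hp1 : p ≤ 1) (a : Fin 2) :
    RY (2 * Real.arctan (Real.sqrt ((1 - p) / p))) a 1 ^ 2 =
      (if a = 1 then p else 1) * (if a = 0 then 1 - p else 1) := by
  have h := cos_sq_arctan_sqrt_one_sub_div hp hp1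
  fin_cases a
  · simp [RY, Real.sin_sq, h]
  · simp [RY, h]

/-- `n` RY gates with parameters `θ(i) = 2·arctan(√((1 − π(i))/π(i)))` prepare the quantum
state of the poss-transferable mass function: the squared entries of the all-ones column of
the Kronecker product of the gates are the poss-transferable masses. -/
theorem RY_kronecker_prepares_possTransferable
    (n : ℕ) (hn : 1 ≤ n) (π : Fin n → ℝ) (hπ : ∀ i, 0 < π i ∧ π i ≤ 1)
    (θ : Fin n → ℝ) (hθ : ∀ i, θ i = 2 * Real.arctan (Real.sqrt ((1 - π i) / π i)))
    (U : Matrix (Fin n → Fin 2) (Fin n → Fin 2) ℝ)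
    (hU : ∀ x y : Fin n → Fin 2, U x y = ∏ i, RY (θ i) (x i) (y i)) :
    ∀ x : Fin n → Fin 2,
      (U x (fun _ => 1)) ^ 2 =
        (∏ i ∈ Finset.univ.filter (fun i => x i = 1), π i) *
          ∏ i ∈ Finset.univ.filter (fun i => x i = 0), (1 - π i) := by
  intro x
  rw [hU, ← Finset.prod_pow, Finset.prod_filter, Finset.prod_filter, ← Finset.prod_mul_distrib]
  refine Finset.prod_congr rfl fun i _ => ?_
  rw [hθ, RY_two_mul_arctan_apply_one_sq (hπ i).1 (hπ i).2]
end

section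
/- Let Ω be a finite set, α ∈ ℝ, and for ω ∈ Ω define the matrix K^{∩,α}_{ω̄} : Matrix (Finset Ω) (Finset Ω) ℝ by K^{∩,α}_{ω̄}(A, B) = 1 if ω ∉ A and B = A ∪ {ω}; = α if ω ∉ B and A = B; = 1−α if ω ∉ B and A = B ∪ {ω}; = 0 otherwise. For F ⊆ Ω let K^{∩,α}_F be the matrix product of K^{∩,α}_{ω̄} over ω ∈ Ω \ F (in any fixed order; K^{∩,α}_Ω is the identity matrix). Then K^{∩,α}_F is the Kronecker product of 2×2 factors: for all A, B ⊆ Ω, K^{∩,α}_F(A, B) = ∏_{ω ∈ Ω \ F} C^{∩,α}(χ_A(ω), χ_B(ω)) · ∏_{ω ∈ F} [χ_A(ω) = χ_B(ω)], where χ_S(ω) ∈ {0,1} indicates membership of ω in S and C^{∩,α} is the 2×2 matrix with C(0,0) = α, C(0,1) = 1, C(1,0) = 1−α, C(1,1) = 0. In particular the matrix product over Ω \ F is independent of the chosen order. -/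
open Finset

/-- Indicator of membership of `ω` in `S`, valued in `{0, 1}`. -/
def chi {Ω : Type*} [DecidableEq Ω] (S : Finset Ω) (ω : Ω) : Fin 2 :=
  if ω ∈ S then 1 else 0

/-- The elementary matrix `K^{∩,α}_{ω̄}` of Smets's conjunctive α-junction. -/
def KconElem {Ω : Type*} [Fintype Ω] [DecidableEq Ω] (α : ℝ) (ω : Ω) :
    Matrix (Finset Ω) (Finset Ω) ℝ :=
  Matrix.of fun A B =>
    if ω ∉ A ∧ B = A ∪ {ω} then 1
    else if ω ∉ B ∧ A = B then α
    else if ω ∉ B ∧ A = B ∪ {ω} then 1 - α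
    else 0

theorem chi_erase_self {Ω : Type*} [DecidableEq Ω] (S : Finset Ω) (ω : Ω) :
    chi (S.erase ω) ω = 0 := by
  simp [chi]

theorem chi_insert_self {Ω : Type*} [DecidableEq Ω] (S : Finset Ω) (ω : Ω) :
    chi (insert ω S) ω = 1 := by
  simp [chi]

theorem chi_erase_of_ne {Ω : Type*} [DecidableEq Ω] (S : Finset Ω) {ω ω' : Ω} (h : ω' ≠ ω) :
    chi (S.erase ω) ω' = chi S ω' := by
  simp [chi, h]

theorem chi_insert_of_ne {Ω : Type*} [DecidableEq Ω] (S : Finset Ω) {ω ω' : Ω} (h : ω' ≠ ω) :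
    chi (insert ω S) ω' = chi S ω' := by
  simp [chi, h]

theorem prod_chi_eq_ite {Ω : Type*} [Fintype Ω] [DecidableEq Ω] (A B : Finset Ω) :
    ∏ ω, (if chi A ω = chi B ω then (1 : ℝ) else 0) = if A = B then 1 else 0 := by
  rw [Finset.prod_ite_zero]
  have h : (∀ ω, chi A ω = chi B ω) ↔ A = B := by
    refine ⟨fun h => ?_, fun h => by simp [h]⟩
    ext ω
    have hω := h ω
    by_cases hA : ω ∈ A <;> by_cases hB : ω ∈ B <;> simp_all [chi]
  simp [h]

/-- A row of `KconElem α ω` is supported on the two sets that agree with `A` away from `ω`. -/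
theorem KconElem_apply {Ω : Type*} [Fintype Ω] [DecidableEq Ω] (α : ℝ) (ω : Ω)
    (A D : Finset Ω) :
    KconElem α ω A D =
      (if D = A.erase ω then
        (!![α, 1; 1 - α, 0] : Matrix (Fin 2) (Fin 2) ℝ) (chi A ω) 0 else 0) +
      (if D = insert ω A then
        (!![α, 1; 1 - α, 0] : Matrix (Fin 2) (Fin 2) ℝ) (chi A ω) 1 else 0) := by
  by_cases hA : ω ∈ A
  · have h : (ω ∉ D ∧ A = insert ω D) ↔ D = A.erase ω := by
      constructor
      · rintro ⟨hD, rfl⟩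
        ext x
        grind
      · rintro rfl
        exact ⟨by simp, by ext x; grind⟩
    have h' : ¬(ω ∉ D ∧ A = D) := by
      rintro ⟨hD, rfl⟩
      exact hD hA
    simp [KconElem, chi, hA, h, h']
  · have h₁ : ¬(ω ∉ D ∧ A = insert ω D) := by
      rintro ⟨-, rfl⟩
      simp at hA
    have h₂ : (ω ∉ D ∧ A = D) ↔ D = A := by
      constructor
      · exact fun h => h.2.symm
      · rintro rfl
        exact ⟨hA, rfl⟩
    have h₃ : A ≠ insert ω A := fun h => hA (h ▸ mem_insert_self ω A)
    by_cases hD : D = A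
    · subst hD
      simp [KconElem, chi, hA, h₃]
    · simp [KconElem, chi, hA, h₁, h₂, hD]

theorem KconElem_mul_apply {Ω : Type*} [Fintype Ω] [DecidableEq Ω] (α : ℝ) (ω : Ω)
    (M : Matrix (Finset Ω) (Finset Ω) ℝ) (A B : Finset Ω) :
    (KconElem α ω * M) A B =
      (!![α, 1; 1 - α, 0] : Matrix (Fin 2) (Fin 2) ℝ) (chi A ω) 0 * M (A.erase ω) B +
      (!![α, 1; 1 - α, 0] : Matrix (Fin 2) (Fin 2) ℝ) (chi A ω) 1 * M (insert ω A) B := by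
  simp only [Matrix.mul_apply, KconElem_apply, add_mul, sum_add_distrib, ite_mul, zero_mul,
    sum_ite_eq', mem_univ, if_true]

theorem prod_map_KconElem_apply {Ω : Type*} [Fintype Ω] [DecidableEq Ω] (α : ℝ)
    (l : List Ω) (hnd : l.Nodup) (A B : Finset Ω) :
    (l.map (KconElem α)).prod A B =
      (∏ ω ∈ l.toFinset,
        (!![α, 1; 1 - α, 0] : Matrix (Fin 2) (Fin 2) ℝ) (chi A ω) (chi B ω)) *
        ∏ ω ∈ l.toFinsetᶜ, (if chi A ω = chi B ω then (1 : ℝ) else 0) := by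
  induction l generalizing A with
  | nil => simp [prod_chi_eq_ite, Matrix.one_apply]
  | cons ω l ih =>
    obtain ⟨hω, hnd⟩ := List.nodup_cons.mp hnd
    have hcompl : l.toFinsetᶜ = insert ω (insert ω l.toFinset)ᶜ := by
      ext x
      by_cases hx : x = ω <;> simp [hx, hω]
    have key (A' : Finset Ω) (hA' : ∀ x, x ≠ ω → chi A' x = chi A x) :
        (l.map (KconElem α)).prod A' B =
          (if chi A' ω = chi B ω then 1 else 0) *
          ((∏ x ∈ l.toFinset,
            (!![α, 1; 1 - α, 0] : Matrix (Fin 2) (Fin 2) ℝ) (chi A x) (chi B x)) *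
            ∏ x ∈ (insert ω l.toFinset)ᶜ, (if chi A x = chi B x then (1 : ℝ) else 0)) := by
      rw [ih hnd, hcompl, prod_insert (by simp), mul_left_comm]
      congr 2
      · refine prod_congr rfl fun x hx => ?_
        rw [hA' x fun h => hω (h ▸ List.mem_toFinset.mp hx)]
      · refine prod_congr rfl fun x hx => ?_
        rw [hA' x fun h => by simp [h] at hx]
    rw [List.map_cons, List.prod_cons, KconElem_mul_apply,
      key _ fun x hx => chi_erase_of_ne A hx, key _ fun x hx => chi_insert_of_ne A hx,
      chi_erase_self, chi_insert_self, List.toFinset_cons,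
      prod_insert (by simpa using hω), mul_assoc]
    generalize chi B ω = b
    fin_cases b <;> simp

/-- The matrix product of the `K^{∩,α}_{ω̄}` over `ω ∈ Ω \ F` (in any order) is the
Kronecker product of 2×2 factors `C^{∩,α}` (on `Ω \ F`) and identities (on `F`);
in particular it does not depend on the chosen order. -/
theorem KconF_eq_kronecker {Ω : Type*} [Fintype Ω] [DecidableEq Ω] (α : ℝ)
    (F : Finset Ω) (l : List Ω) (hnd : l.Nodup) (hl : l.toFinset = Fᶜ) :
    ∀ A B : Finset Ω,
      (l.map (KconElem α)).prod A B =
        (∏ ω ∈ Fᶜ, (!![α, 1; 1 - α, 0] : Matrix (Fin 2) (Fin 2) ℝ) (chi A ω) (chi B ω)) *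
          ∏ ω ∈ F, (if chi A ω = chi B ω then (1 : ℝ) else 0) := by
  intro A B
  rw [prod_map_KconElem_apply α l hnd, hl, compl_compl]
end

section
/- Let Ω be a finite set, α ∈ ℝ, and for ω ∈ Ω define the matrix K^{∪,α}_{ω} : Matrix (Finset Ω) (Finset Ω) ℝ by K^{∪,α}_{ω}(A, B) = 1 if ω ∉ B and A = B ∪ {ω}; = α if ω ∈ B and A = B; = 1−α if ω ∉ A and B = A ∪ {ω}; = 0 otherwise. For F ⊆ Ω let K^{∪,α}_F be the matrix product of K^{∪,α}_{ω} over ω ∈ F (in any fixed order; K^{∪,α}_∅ is the identity matrix). Then for all A, B ⊆ Ω, K^{∪,α}_F(A, B) = ∏_{ω ∈ F} C^{∪,α}(χ_A(ω), χ_B(ω)) · ∏_{ω ∉ F} [χ_A(ω) = χ_B(ω)], where χ_S(ω) ∈ {0,1} indicates membership of ω in S and C^{∪,α} is the 2×2 matrix with C(0,0) = 0, C(0,1) = 1−α, C(1,0) = 1, C(1,1) = α. In particular the matrix product over F is independent of the chosen order. -/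
open Finset

/-- The elementary matrix `K^{∪,α}_{ω}` of Smets's disjunctive α-junction. -/
def KdisElem {Ω : Type*} [Fintype Ω] [DecidableEq Ω] (α : ℝ) (ω : Ω) :
    Matrix (Finset Ω) (Finset Ω) ℝ :=
  Matrix.of fun A B =>
    if ω ∉ B ∧ A = B ∪ {ω} then 1
    else if ω ∈ B ∧ A = B then α
    else if ω ∉ A ∧ B = A ∪ {ω} then 1 - α
    else 0

/-- The Kronecker product of a family of 2×2 matrices, with index tuples in `{0, 1}^Ω` encoded
as subsets of `Ω` via `chi`. It is multiplicative in the family. -/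
def kroneckerHom (Ω : Type*) [Fintype Ω] [DecidableEq Ω] :
    (Ω → Matrix (Fin 2) (Fin 2) ℝ) →* Matrix (Finset Ω) (Finset Ω) ℝ where
  toFun M := Matrix.of fun A B => ∏ ω, M ω (chi A ω) (chi B ω)
  map_one' := by
    ext A B
    simp only [Matrix.of_apply, Pi.one_apply, Matrix.one_apply, Finset.prod_ite_zero,
      Finset.prod_const_one]
    refine if_congr ?_ rfl rfl
    simp only [chi, Finset.ext_iff, mem_univ, true_imp_iff]
    refine forall_congr' fun ω => ?_
    by_cases hA : ω ∈ A <;> by_cases hB : ω ∈ B <;> simp [hA, hB]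
  map_mul' M N := by
    ext A B
    simp only [Matrix.of_apply, Pi.mul_apply, Matrix.mul_apply, Fin.sum_univ_two]
    simp_rw [add_comm (M _ _ 0 * _)]
    rw [Finset.prod_add, powerset_univ]
    refine Finset.sum_congr rfl fun C _ => ?_
    rw [← Finset.prod_mul_distrib, ← Finset.prod_mul_prod_compl C, ← Finset.compl_eq_univ_sdiff]
    congr 1 <;> refine Finset.prod_congr rfl fun ω hω => ?_
    · simp [chi, hω]
    · simp [chi, Finset.mem_compl.mp hω]

theorem kroneckerHom_apply {Ω : Type*} [Fintype Ω] [DecidableEq Ω]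
    (M : Ω → Matrix (Fin 2) (Fin 2) ℝ) (A B : Finset Ω) :
    kroneckerHom Ω M A B = ∏ ω, M ω (chi A ω) (chi B ω) := rfl

theorem KdisElem_eq_kroneckerHom {Ω : Type*} [Fintype Ω] [DecidableEq Ω] (α : ℝ) (ω : Ω) :
    KdisElem α ω = kroneckerHom Ω (Pi.mulSingle ω !![0, 1 - α; 1, α]) := by
  ext A B
  rw [kroneckerHom_apply, ← Finset.mul_prod_erase _ _ (mem_univ ω), Pi.mulSingle_eq_same]
  have hrest : ∏ i ∈ univ.erase ω,
      (Pi.mulSingle ω !![0, 1 - α; 1, α] : Ω → Matrix (Fin 2) (Fin 2) ℝ) i (chi A i) (chi B i) =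
        if ∀ i, i ≠ ω → (i ∈ A ↔ i ∈ B) then 1 else 0 := by
    trans ∏ i ∈ univ.erase ω, if (i ∈ A ↔ i ∈ B) then (1 : ℝ) else 0
    · refine Finset.prod_congr rfl fun i hi => ?_
      rw [Pi.mulSingle_eq_of_ne (Finset.ne_of_mem_erase hi), Matrix.one_apply]
      by_cases hA : i ∈ A <;> by_cases hB : i ∈ B <;> simp [chi, hA, hB]
    · rw [Finset.prod_ite_zero]
      simp
  rw [hrest]
  have h₁ : (ω ∉ B ∧ A = B ∪ {ω}) ↔ ω ∈ A ∧ ω ∉ B ∧ ∀ i, i ≠ ω → (i ∈ A ↔ i ∈ B) := by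
    grind
  have h₂ : (ω ∈ B ∧ A = B) ↔ ω ∈ A ∧ ω ∈ B ∧ ∀ i, i ≠ ω → (i ∈ A ↔ i ∈ B) := by
    grind
  have h₃ : (ω ∉ A ∧ B = A ∪ {ω}) ↔ ω ∉ A ∧ ω ∈ B ∧ ∀ i, i ≠ ω → (i ∈ A ↔ i ∈ B) := by
    grind
  simp only [KdisElem, Matrix.of_apply, h₁, h₂, h₃]
  by_cases hA : ω ∈ A <;> by_cases hB : ω ∈ B <;> simp [chi, hA, hB]

theorem List.Nodup.prod_map_mulSingle {ι M : Type*} [DecidableEq ι] [Monoid M] (x : M)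
    {l : List ι} (hl : l.Nodup) (i : ι) :
    (l.map fun j => (Pi.mulSingle j x : ι → M)).prod i = if i ∈ l then x else 1 := by
  induction l with
  | nil => simp
  | cons j l ih =>
    obtain ⟨hj, hl⟩ := List.nodup_cons.mp hl
    rw [List.map_cons, List.prod_cons, Pi.mul_apply, ih hl]
    by_cases h : i = j
    · subst h
      simp [hj]
    · simp [h]

/-- The matrix product of the `K^{∪,α}_{ω}` over `ω ∈ F` (in any order) is the Kronecker
product of 2×2 factors `C^{∪,α}` (on `F`) and identities (on `Ω \ F`); in particular it
does not depend on the chosen order. -/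
theorem KdisF_eq_kronecker {Ω : Type*} [Fintype Ω] [DecidableEq Ω] (α : ℝ)
    (F : Finset Ω) (l : List Ω) (hnd : l.Nodup) (hl : l.toFinset = F) :
    ∀ A B : Finset Ω,
      (l.map (KdisElem α)).prod A B =
        (∏ ω ∈ F, (!![0, 1 - α; 1, α] : Matrix (Fin 2) (Fin 2) ℝ) (chi A ω) (chi B ω)) *
          ∏ ω ∈ Fᶜ, (if chi A ω = chi B ω then (1 : ℝ) else 0) := by
  intro A B
  subst hl
  have hprod : (l.map (KdisElem α)).prod = kroneckerHom Ω
      (l.map fun ω => (Pi.mulSingle ω !![0, 1 - α; 1, α] : Ω → Matrix (Fin 2) (Fin 2) ℝ)).prod := by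
    rw [map_list_prod, List.map_map]
    exact congrArg List.prod (List.map_congr_left fun ω _ => KdisElem_eq_kroneckerHom α ω)
  rw [hprod, kroneckerHom_apply, ← Finset.prod_mul_prod_compl l.toFinset]
  congr 1 <;> refine Finset.prod_congr rfl fun ω hω => ?_
  · rw [hnd.prod_map_mulSingle, if_pos (List.mem_toFinset.mp hω)]
  · rw [hnd.prod_map_mulSingle, if_neg (by simpa using hω), Matrix.one_apply]
end

section
/- Let Ω be a finite set and m₁, m₂ : Finset Ω → ℝ. With α = 1, the conjunctive α-junction degrades to the conjunctive combination rule: for every H ⊆ Ω, ( Σ_{F ⊆ Ω} m₂(F) · K^{∩,1}_F ·ᵥ m₁ )(H) = Σ_{A ∩ B = H} m₁(A)·m₂(B), where K^{∩,1}_F is the matrix with entries K^{∩,1}_F(A, B) = ∏_{ω ∈ Ω \ F} C^{∩,1}(χ_A(ω), χ_B(ω)) · ∏_{ω ∈ F} [χ_A(ω) = χ_B(ω)] and C^{∩,1} has entries C(0,0) = 1, C(0,1) = 1, C(1,0) = 0, C(1,1) = 0. -/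
open Finset

/-- The matrix `K^{∩,1}_F` of the conjunctive α-junction at `α = 1`, given by its
Kronecker-product entries with `C^{∩,1} = [[1, 1], [0, 0]]`. -/
def Kcon1 {Ω : Type*} [Fintype Ω] [DecidableEq Ω] (F : Finset Ω) :
    Matrix (Finset Ω) (Finset Ω) ℝ :=
  Matrix.of fun A B =>
    (∏ ω ∈ Fᶜ, (!![1, 1; 0, 0] : Matrix (Fin 2) (Fin 2) ℝ) (chi A ω) (chi B ω)) *
      ∏ ω ∈ F, (if chi A ω = chi B ω then (1 : ℝ) else 0)

/-- For `α = 1`, the matrix `K_F` is the `0`-`1` matrix of the map `B ↦ B ∩ F`. -/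
theorem Kcon1_apply {Ω : Type*} [Fintype Ω] [DecidableEq Ω] (F A B : Finset Ω) :
    Kcon1 F A B = if B ∩ F = A then 1 else 0 := by
  have hC : ∀ ω, (!![1, 1; 0, 0] : Matrix (Fin 2) (Fin 2) ℝ) (chi A ω) (chi B ω) =
      if ω ∉ A then 1 else 0 := by
    intro ω
    by_cases hA : ω ∈ A <;> by_cases hB : ω ∈ B <;> simp [chi, hA, hB]
  have hI : ∀ ω, chi A ω = chi B ω ↔ (ω ∈ A ↔ ω ∈ B) := by
    intro ω
    by_cases hA : ω ∈ A <;> by_cases hB : ω ∈ B <;> simp [chi, hA, hB]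
  rw [Kcon1, Matrix.of_apply]
  simp only [hC, hI, Finset.prod_ite_zero, Finset.prod_const_one, Finset.ext_iff,
    Finset.mem_inter, Finset.mem_compl]
  split_ifs <;> grind

/-- With `α = 1` the conjunctive α-junction degrades to the conjunctive combination rule. -/
theorem conjunctive_alpha_junction_one_eq_ccr {Ω : Type*} [Fintype Ω] [DecidableEq Ω]
    (m₁ m₂ : Finset Ω → ℝ) :
    ∀ H : Finset Ω,
      (∑ F : Finset Ω, m₂ F * (Kcon1 F).mulVec m₁ H) =
        ∑ p ∈ Finset.univ.filter (fun p : Finset Ω × Finset Ω => p.1 ∩ p.2 = H),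
          m₁ p.1 * m₂ p.2 := by
  intro H
  rw [Finset.sum_filter, Fintype.sum_prod_type_right]
  refine Finset.sum_congr rfl fun F _ => ?_
  simp only [Matrix.mulVec, dotProduct, Kcon1_apply, Finset.mul_sum]
  refine Finset.sum_congr rfl fun A _ => ?_
  split_ifs <;> ring
end

section
/- Let Ω be a finite set and m₁, m₂ : Finset Ω → ℝ. With α = 1, the disjunctive α-junction degrades to the disjunctive combination rule: for every H ⊆ Ω, ( Σ_{F ⊆ Ω} m₂(F) · K^{∪,1}_F ·ᵥ m₁ )(H) = Σ_{A ∪ B = H} m₁(A)·m₂(B), where K^{∪,1}_F is the matrix with entries K^{∪,1}_F(A, B) = ∏_{ω ∈ F} C^{∪,1}(χ_A(ω), χ_B(ω)) · ∏_{ω ∉ F} [χ_A(ω) = χ_B(ω)] and C^{∪,1} has entries C(0,0) = 0, C(0,1) = 0, C(1,0) = 1, C(1,1) = 1. -/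
open Finset

/-- The matrix `K^{∪,1}_F` of the disjunctive α-junction at `α = 1`, given by its
Kronecker-product entries with `C^{∪,1} = [[0, 0], [1, 1]]`. -/
def Kdis1 {Ω : Type*} [Fintype Ω] [DecidableEq Ω] (F : Finset Ω) :
    Matrix (Finset Ω) (Finset Ω) ℝ :=
  Matrix.of fun A B =>
    (∏ ω ∈ F, (!![0, 0; 1, 1] : Matrix (Fin 2) (Fin 2) ℝ) (chi A ω) (chi B ω)) *
      ∏ ω ∈ Fᶜ, (if chi A ω = chi B ω then (1 : ℝ) else 0)

/-- The entry of `Kdis1 F` at `(A, B)` indicates whether `A` is the union of `B` and `F`. -/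
theorem Kdis1_apply {Ω : Type*} [Fintype Ω] [DecidableEq Ω] (F A B : Finset Ω) :
    Kdis1 F A B = if B ∪ F = A then 1 else 0 := by
  have entry (ω : Ω) : (!![0, 0; 1, 1] : Matrix (Fin 2) (Fin 2) ℝ) (chi A ω) (chi B ω) =
      if ω ∈ A then 1 else 0 := by
    by_cases hA : ω ∈ A <;> by_cases hB : ω ∈ B <;> simp [chi, hA, hB]
  have chi_eq (ω : Ω) : chi A ω = chi B ω ↔ (ω ∈ A ↔ ω ∈ B) := by
    by_cases hA : ω ∈ A <;> by_cases hB : ω ∈ B <;> simp [chi, hA, hB]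
  have union_eq : B ∪ F = A ↔ (∀ ω ∈ F, ω ∈ A) ∧ ∀ ω ∈ Fᶜ, (ω ∈ A ↔ ω ∈ B) := by
    simp only [Finset.ext_iff, Finset.mem_union, Finset.mem_compl]
    grind
  rw [Kdis1, Matrix.of_apply, Finset.prod_congr rfl fun ω _ => entry ω]
  simp only [chi_eq, Finset.prod_boole, union_eq, ite_and, ite_mul, one_mul, zero_mul]
  congr

/-- With `α = 1` the disjunctive α-junction degrades to the disjunctive combination rule. -/
theorem disjunctive_alpha_junction_one_eq_dcr {Ω : Type*} [Fintype Ω] [DecidableEq Ω]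
    (m₁ m₂ : Finset Ω → ℝ) :
    ∀ H : Finset Ω,
      (∑ F : Finset Ω, m₂ F * (Kdis1 F).mulVec m₁ H) =
        ∑ p ∈ Finset.univ.filter (fun p : Finset Ω × Finset Ω => p.1 ∪ p.2 = H),
          m₁ p.1 * m₂ p.2 := by
  intro H
  simp only [Matrix.mulVec, dotProduct, Kdis1_apply, Finset.sum_filter, Fintype.sum_prod_type,
    Finset.mul_sum]
  rw [Finset.sum_comm]
  refine Finset.sum_congr rfl fun B _ => Finset.sum_congr rfl fun F _ => ?_
  split_ifs <;> ring
end

section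
/- Let Ω be a finite set, α ∈ [0,1], and m₂ a mass function on Ω. Then the α-junction matrix K^{∩,α}_{m₂} = Σ_{F ⊆ Ω} m₂(F)·K^{∩,α}_F (with K^{∩,α}_F(A, B) = ∏_{ω ∉ F} C^{∩,α}(χ_A(ω), χ_B(ω)) · ∏_{ω ∈ F} [χ_A(ω) = χ_B(ω)], where C^{∩,α}(0,0) = α, C^{∩,α}(0,1) = 1, C^{∩,α}(1,0) = 1−α, C^{∩,α}(1,1) = 0) has all entries nonnegative and every column summing to 1. Consequently, for every mass function m₁ on Ω, the vector K^{∩,α}_{m₂} ·ᵥ m₁ is again a mass function. -/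
open Finset

/-- The matrix `K^{∩,α}_F` of the conjunctive α-junction, given by its Kronecker-product
entries with `C^{∩,α} = [[α, 1], [1−α, 0]]`. -/
def KconF {Ω : Type*} [Fintype Ω] [DecidableEq Ω] (α : ℝ) (F : Finset Ω) :
    Matrix (Finset Ω) (Finset Ω) ℝ :=
  Matrix.of fun A B =>
    (∏ ω ∈ Fᶜ, (!![α, 1; 1 - α, 0] : Matrix (Fin 2) (Fin 2) ℝ) (chi A ω) (chi B ω)) *
      ∏ ω ∈ F, (if chi A ω = chi B ω then (1 : ℝ) else 0)

/-- The α-junction matrix `K^{∩,α}_{m₂} = Σ_F m₂(F)·K^{∩,α}_F`. -/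
def KconM {Ω : Type*} [Fintype Ω] [DecidableEq Ω] (α : ℝ) (m₂ : Finset Ω → ℝ) :
    Matrix (Finset Ω) (Finset Ω) ℝ :=
  ∑ F : Finset Ω, m₂ F • KconF α F

/-- Summing a product over all subsets, encoded by their indicators, factorizes. -/
theorem sum_prod_chi {Ω R : Type*} [Fintype Ω] [DecidableEq Ω] [CommSemiring R]
    (f : Ω → Fin 2 → R) :
    ∑ A : Finset Ω, ∏ ω, f ω (chi A ω) = ∏ ω, ∑ i, f ω i := by
  simp_rw [Fin.sum_univ_two, add_comm (f _ 0)]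
  rw [Fintype.prod_add]
  refine Finset.sum_congr rfl fun A _ => ?_
  rw [← Finset.prod_mul_prod_compl A]
  congr 1 <;> refine Finset.prod_congr rfl fun ω hω => ?_
  · simp [chi, hω]
  · simp [chi, Finset.mem_compl.mp hω]

theorem KconF_nonneg {Ω : Type*} [Fintype Ω] [DecidableEq Ω] {α : ℝ}
    (hα : 0 ≤ α ∧ α ≤ 1) (F A B : Finset Ω) : 0 ≤ KconF α F A B := by
  refine mul_nonneg (Finset.prod_nonneg fun ω _ => ?_) (Finset.prod_nonneg fun ω _ => ?_)
  · generalize chi A ω = i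
    generalize chi B ω = j
    fin_cases i <;> fin_cases j <;> simp [hα.1, hα.2]
  · split_ifs <;> norm_num

/-- `K^{∩,α}_F` as a single product over `Ω` of coordinate matrices. -/
theorem KconF_eq_prod {Ω : Type*} [Fintype Ω] [DecidableEq Ω] (α : ℝ) (F A B : Finset Ω) :
    KconF α F A B = ∏ ω, (if ω ∈ F then (1 : Matrix (Fin 2) (Fin 2) ℝ)
      else !![α, 1; 1 - α, 0]) (chi A ω) (chi B ω) := by
  rw [← Finset.prod_compl_mul_prod F]
  refine congrArg₂ (HMul.hMul (α := ℝ) (β := ℝ)) (Finset.prod_congr rfl fun ω hω => ?_)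
    (Finset.prod_congr rfl fun ω hω => ?_)
  · rw [if_neg (Finset.mem_compl.mp hω)]
  · rw [if_pos hω, Matrix.one_apply]

theorem sum_KconF {Ω : Type*} [Fintype Ω] [DecidableEq Ω] (α : ℝ) (F B : Finset Ω) :
    ∑ A : Finset Ω, KconF α F A B = 1 := by
  simp_rw [KconF_eq_prod]
  rw [sum_prod_chi fun ω i => (if ω ∈ F then (1 : Matrix (Fin 2) (Fin 2) ℝ)
    else !![α, 1; 1 - α, 0]) i (chi B ω)]
  refine Finset.prod_eq_one fun ω _ => ?_
  generalize chi B ω = j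
  split_ifs
  · simp [Matrix.one_apply, -Fin.sum_univ_two]
  · fin_cases j <;> simp

theorem KconM_apply {Ω : Type*} [Fintype Ω] [DecidableEq Ω] (α : ℝ) (m₂ : Finset Ω → ℝ)
    (A B : Finset Ω) : KconM α m₂ A B = ∑ F, m₂ F * KconF α F A B := by
  simp [KconM, Matrix.sum_apply]

/-- For `α ∈ [0,1]` and a mass function `m₂`, the α-junction matrix `K^{∩,α}_{m₂}` has
nonnegative entries and columns summing to `1`; consequently it maps mass functions to
mass functions. -/
theorem KconM_stochastic {Ω : Type*} [Fintype Ω] [DecidableEq Ω]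
    (α : ℝ) (hα : 0 ≤ α ∧ α ≤ 1) (m₂ : Finset Ω → ℝ)
    (hm₂ : ∀ F, 0 ≤ m₂ F) (hm₂1 : ∑ F : Finset Ω, m₂ F = 1) :
    (∀ A B : Finset Ω, 0 ≤ KconM α m₂ A B) ∧
      (∀ B : Finset Ω, ∑ A : Finset Ω, KconM α m₂ A B = 1) ∧
      ∀ m₁ : Finset Ω → ℝ, (∀ F, 0 ≤ m₁ F) → (∑ F : Finset Ω, m₁ F = 1) →
        (∀ H : Finset Ω, 0 ≤ (KconM α m₂).mulVec m₁ H) ∧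
          ∑ H : Finset Ω, (KconM α m₂).mulVec m₁ H = 1 := by
  have hnonneg (A B : Finset Ω) : 0 ≤ KconM α m₂ A B := by
    rw [KconM_apply]
    exact Finset.sum_nonneg fun F _ => mul_nonneg (hm₂ F) (KconF_nonneg hα F A B)
  have hsum (B : Finset Ω) : ∑ A : Finset Ω, KconM α m₂ A B = 1 := by
    simp_rw [KconM_apply]
    rw [Finset.sum_comm]
    simp_rw [← Finset.mul_sum, sum_KconF, mul_one, hm₂1]
  refine ⟨hnonneg, hsum, fun m₁ hm₁ hm₁1 => ⟨fun H => ?_, ?_⟩⟩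
  · exact Finset.sum_nonneg fun B _ => mul_nonneg (hnonneg H B) (hm₁ B)
  · simp_rw [Matrix.mulVec, dotProduct]
    rw [Finset.sum_comm]
    simp_rw [← Finset.sum_mul, hsum, one_mul, hm₁1]
end

section
/- Let Ω be a finite set, β ∈ [0,1], F ⊆ Ω, and m a mass function on Ω with contour function pl_m(ω) = Σ_{G ∋ ω} m(G). Let m⁻ = K^{−,β}_F ·ᵥ m and m⁺ = K^{+,β}_F ·ᵥ m be the contour-reduction and contour-enhancement revisions of m. Then the revisions modify the contour exactly on F and nowhere else: for ω ∈ F, pl_{m⁻}(ω) = (1−β)·pl_m(ω) and pl_{m⁺}(ω) = pl_m(ω) + β·(1 − pl_m(ω)); and for ω ∉ F, pl_{m⁻}(ω) = pl_m(ω) and pl_{m⁺}(ω) = pl_m(ω). -/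
open Finset

/-- The contour function of `m`: `pl_m(ω) = Σ_{G ∋ ω} m(G)`. -/
def contour {Ω : Type*} [Fintype Ω] [DecidableEq Ω] (m : Finset Ω → ℝ) (ω : Ω) : ℝ :=
  ∑ G ∈ Finset.univ.filter (fun G : Finset Ω => ω ∈ G), m G

/-- The contour enhancement revision matrix `K^{+,β}_F`, built from
`E^β = [[1−β, 0], [β, 1]]`. -/
def Kcer {Ω : Type*} [Fintype Ω] [DecidableEq Ω] (β : ℝ) (F : Finset Ω) :
    Matrix (Finset Ω) (Finset Ω) ℝ :=
  Matrix.of fun A B =>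
    (∏ ω ∈ F, (!![1 - β, 0; β, 1] : Matrix (Fin 2) (Fin 2) ℝ) (chi A ω) (chi B ω)) *
      ∏ ω ∈ Fᶜ, (if chi A ω = chi B ω then (1 : ℝ) else 0)

/-- The contour reduction revision matrix `K^{−,β}_F`, built from
`R^β = [[1, β], [0, 1−β]]`. -/
def Kcrr {Ω : Type*} [Fintype Ω] [DecidableEq Ω] (β : ℝ) (F : Finset Ω) :
    Matrix (Finset Ω) (Finset Ω) ℝ :=
  Matrix.of fun A B =>
    (∏ ω ∈ F, (!![1, β; 0, 1 - β] : Matrix (Fin 2) (Fin 2) ℝ) (chi A ω) (chi B ω)) *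
      ∏ ω ∈ Fᶜ, (if chi A ω = chi B ω then (1 : ℝ) else 0)

/-- Summing a product of column-stochastic `2 × 2` factors over the subsets that contain `ω`
leaves only the factor at `ω`. -/
theorem sum_prod_chi_of_mem {Ω : Type*} [Fintype Ω] [DecidableEq Ω]
    (T : Ω → Matrix (Fin 2) (Fin 2) ℝ) (hT : ∀ i b, T i 0 b + T i 1 b = 1)
    (b : Ω → Fin 2) (ω : Ω) :
    ∑ A ∈ univ.filter (fun A : Finset Ω => ω ∈ A), ∏ i, T i (chi A i) (b i) = T ω 1 (b ω) := by
  have h := Finset.prod_add (fun i => T i 1 (b i))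
    (fun i => if i = ω then 0 else T i 0 (b i)) univ
  have hprod : ∏ i, (T i 1 (b i) + if i = ω then 0 else T i 0 (b i)) = T ω 1 (b ω) := by
    rw [Finset.prod_eq_single ω]
    · simp
    · intro i _ hi
      rw [if_neg hi, add_comm, hT]
    · simp
  rw [← hprod, h, powerset_univ, sum_filter]
  refine sum_congr rfl fun A _ => ?_
  split_ifs with hA
  · rw [← prod_mul_prod_compl A, ← compl_eq_univ_sdiff]
    congr 1
    · refine prod_congr rfl fun i hi => ?_
      simp [chi, hi]
    · refine prod_congr rfl fun i hi => ?_
      rw [mem_compl] at hi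
      have hne : i ≠ ω := fun h => hi (h ▸ hA)
      simp [chi, hi, hne]
  · symm
    apply mul_eq_zero_of_right
    exact prod_eq_zero (i := ω) (by simp [hA]) (by simp)

/-- The contour of the revision of `m` by a matrix that factors over `Ω` into column-stochastic
`2 × 2` factors. -/
theorem contour_mulVec_of_prod {Ω : Type*} [Fintype Ω] [DecidableEq Ω]
    (T : Ω → Matrix (Fin 2) (Fin 2) ℝ) (hT : ∀ i b, T i 0 b + T i 1 b = 1)
    (K : Matrix (Finset Ω) (Finset Ω) ℝ) (hK : ∀ A B, K A B = ∏ i, T i (chi A i) (chi B i))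
    (m : Finset Ω → ℝ) (ω : Ω) :
    contour (K.mulVec m) ω =
      T ω 1 1 * contour m ω + T ω 1 0 * (∑ G, m G - contour m ω) := by
  have hc : ∑ G, m G - contour m ω = ∑ G ∈ univ.filter (fun G : Finset Ω => ω ∉ G), m G := by
    rw [contour, ← sum_filter_add_sum_filter_not univ (fun G : Finset Ω => ω ∈ G)]
    ring
  rw [hc]
  simp only [contour, Matrix.mulVec, dotProduct]
  rw [sum_comm]
  simp_rw [← sum_mul, hK, sum_prod_chi_of_mem T hT]
  rw [← sum_filter_add_sum_filter_not univ (fun G : Finset Ω => ω ∈ G), mul_sum, mul_sum]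
  congr 1
  · refine sum_congr rfl fun G hG => ?_
    simp [chi, (mem_filter.mp hG).2]
  · refine sum_congr rfl fun G hG => ?_
    simp [chi, (mem_filter.mp hG).2]

/-- A matrix acting by the `2 × 2` factor `M` at the points of `F` and trivially elsewhere is a
product over all of `Ω`. -/
theorem prod_mul_prod_compl_chi {Ω : Type*} [Fintype Ω] [DecidableEq Ω]
    (M : Matrix (Fin 2) (Fin 2) ℝ) (F A B : Finset Ω) :
    (∏ i ∈ F, M (chi A i) (chi B i)) * ∏ i ∈ Fᶜ, (if chi A i = chi B i then (1 : ℝ) else 0) =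
      ∏ i, (if i ∈ F then M else 1) (chi A i) (chi B i) := by
  rw [← prod_mul_prod_compl F]
  congr 1
  · exact prod_congr rfl fun i hi => by rw [if_pos hi]
  · exact prod_congr rfl fun i hi => by rw [if_neg (mem_compl.mp hi), Matrix.one_apply]

/-- The contour of the revision of `m` by a column-stochastic `2 × 2` factor `M` acting at the
points of `F`. -/
theorem contour_mulVec_of_factor {Ω : Type*} [Fintype Ω] [DecidableEq Ω]
    (M : Matrix (Fin 2) (Fin 2) ℝ) (hM : ∀ b, M 0 b + M 1 b = 1) (F : Finset Ω)
    (K : Matrix (Finset Ω) (Finset Ω) ℝ)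
    (hK : ∀ A B, K A B = (∏ i ∈ F, M (chi A i) (chi B i)) *
      ∏ i ∈ Fᶜ, (if chi A i = chi B i then (1 : ℝ) else 0))
    (m : Finset Ω → ℝ) (ω : Ω) :
    contour (K.mulVec m) ω =
      if ω ∈ F then M 1 1 * contour m ω + M 1 0 * (∑ G, m G - contour m ω)
      else contour m ω := by
  rw [contour_mulVec_of_prod (fun i => if i ∈ F then M else 1) _ K
    fun A B => (hK A B).trans (prod_mul_prod_compl_chi M F A B)]
  · split_ifs <;> simp
  · have h1 : ∀ b, (1 : Matrix (Fin 2) (Fin 2) ℝ) 0 b + (1 : Matrix (Fin 2) (Fin 2) ℝ) 1 b = 1 := by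
      simp [Fin.forall_fin_two]
    intro i b
    split_ifs
    · exact hM b
    · exact h1 b

/-- The contour revisions modify the contour function exactly on `F` and nowhere else:
for `ω ∈ F`, `pl_{m⁻}(ω) = (1−β)·pl_m(ω)` and `pl_{m⁺}(ω) = pl_m(ω) + β·(1 − pl_m(ω))`,
while for `ω ∉ F` both contours are unchanged. -/
theorem contour_of_cer_crr {Ω : Type*} [Fintype Ω] [DecidableEq Ω]
    (β : ℝ) (hβ : 0 ≤ β ∧ β ≤ 1) (F : Finset Ω)
    (m : Finset Ω → ℝ) (hm : ∀ G, 0 ≤ m G) (hm1 : ∑ G : Finset Ω, m G = 1) :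
    (∀ ω ∈ F,
        contour ((Kcrr β F).mulVec m) ω = (1 - β) * contour m ω ∧
        contour ((Kcer β F).mulVec m) ω = contour m ω + β * (1 - contour m ω)) ∧
      ∀ ω ∉ F,
        contour ((Kcrr β F).mulVec m) ω = contour m ω ∧
        contour ((Kcer β F).mulVec m) ω = contour m ω := by
  have hR := contour_mulVec_of_factor !![1, β; 0, 1 - β] (fun b => by fin_cases b <;> simp) F
    (Kcrr β F) (fun _ _ => rfl) m
  have hE := contour_mulVec_of_factor !![1 - β, 0; β, 1] (fun b => by fin_cases b <;> simp) F
    (Kcer β F) (fun _ _ => rfl) m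
  refine ⟨fun ω hω => ?_, fun ω hω => ?_⟩
  · rw [hR, hE, if_pos hω, if_pos hω, hm1]
    simp
  · rw [hR, hE, if_neg hω, if_neg hω]
    exact ⟨rfl, rfl⟩
end

section
/- Let Ω and Θ be finite sets, let H ⊆ Θ be nonempty, and let m₀ be a mass function on Ω (interpreted as the conditional mass function m^Ω[H]). Define its ballooning extension M : Finset (Ω × Θ) → ℝ by M(G) = m₀(F) if G = (F ×ˢ H) ∪ (Ω ×ˢ (Θ \ H)) for some F ⊆ Ω, and M(G) = 0 otherwise; let c be the categorical mass function on Ω × Θ with c(Ω ×ˢ H) = 1 and c = 0 elsewhere; let (M ⊓ c)(G) = Σ_{G₁ ∩ G₂ = G} M(G₁)·c(G₂) be their conjunctive combination; and let ↓Ω denote marginalization onto Ω via the first projection. Then conditioning inverts the ballooning extension: ((M ⊓ c)↓Ω)(F) = m₀(F) for every F ⊆ Ω. -/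
open Finset

/-- The ballooning extension of a conditional mass function `m₀ = m^Ω[H]` to `Ω × Θ`:
it places `m₀(F)` on `(F ×ˢ H) ∪ (Ω ×ˢ (Θ \ H))` and `0` elsewhere. -/
noncomputable def ballooningExtension {Ω Θ : Type*} [Fintype Ω] [DecidableEq Ω]
    [Fintype Θ] [DecidableEq Θ] (H : Finset Θ) (m₀ : Finset Ω → ℝ)
    (G : Finset (Ω × Θ)) : ℝ :=
  if h : ∃ F : Finset Ω,
      G = (F ×ˢ H) ∪ ((Finset.univ : Finset Ω) ×ˢ ((Finset.univ : Finset Θ) \ H)) then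
    m₀ h.choose
  else 0

/-- The categorical mass function on `Ω × Θ` with single focal set `Ω ×ˢ H`. -/
def categorical {Ω Θ : Type*} [Fintype Ω] [DecidableEq Ω] [Fintype Θ] [DecidableEq Θ]
    (H : Finset Θ) (G : Finset (Ω × Θ)) : ℝ :=
  if G = (Finset.univ : Finset Ω) ×ˢ H then 1 else 0

/-- The conjunctive combination rule on `Ω × Θ`. -/
def conjComb {Ω Θ : Type*} [Fintype Ω] [DecidableEq Ω] [Fintype Θ] [DecidableEq Θ]
    (M₁ M₂ : Finset (Ω × Θ) → ℝ) (G : Finset (Ω × Θ)) : ℝ :=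
  ∑ p ∈ Finset.univ.filter
      (fun p : Finset (Ω × Θ) × Finset (Ω × Θ) => p.1 ∩ p.2 = G),
    M₁ p.1 * M₂ p.2

/-- The marginalization of `M : Finset (Ω × Θ) → ℝ` onto `Ω`. -/
def marginalization {Ω Θ : Type*} [Fintype Ω] [DecidableEq Ω]
    [Fintype Θ] [DecidableEq Θ] (M : Finset (Ω × Θ) → ℝ) (F : Finset Ω) : ℝ :=
  ∑ G ∈ Finset.univ.filter (fun G : Finset (Ω × Θ) => G.image Prod.fst = F), M G

/-- Intersecting a ballooned set with `Ω ×ˢ H` and projecting to `Ω` recovers the original set. -/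
lemma image_fst_balloon_inter {Ω Θ : Type*} [Fintype Ω] [DecidableEq Ω]
    [Fintype Θ] [DecidableEq Θ] {H : Finset Θ} (hH : H.Nonempty) (F : Finset Ω) :
    (((F ×ˢ H) ∪ ((Finset.univ : Finset Ω) ×ˢ ((Finset.univ : Finset Θ) \ H))) ∩
      ((Finset.univ : Finset Ω) ×ˢ H)).image Prod.fst = F := by
  obtain ⟨θ, hθ⟩ := hH
  ext ω
  simp only [mem_image, mem_inter, mem_union, mem_product, mem_sdiff, mem_univ, true_and,
    Prod.exists, exists_and_right, exists_eq_right]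
  constructor
  · rintro ⟨x, h | h, hx⟩
    · exact h.1
    · exact absurd hx h
  · exact fun h => ⟨θ, Or.inl ⟨h, hθ⟩, hθ⟩

lemma ballooningExtension_balloon {Ω Θ : Type*} [Fintype Ω] [DecidableEq Ω]
    [Fintype Θ] [DecidableEq Θ] {H : Finset Θ} (hH : H.Nonempty)
    (m₀ : Finset Ω → ℝ) (F : Finset Ω) :
    ballooningExtension H m₀
      ((F ×ˢ H) ∪ ((Finset.univ : Finset Ω) ×ˢ ((Finset.univ : Finset Θ) \ H))) = m₀ F := by
  have h : ∃ F' : Finset Ω,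
      (F ×ˢ H) ∪ ((Finset.univ : Finset Ω) ×ˢ ((Finset.univ : Finset Θ) \ H)) =
        (F' ×ˢ H) ∪ ((Finset.univ : Finset Ω) ×ˢ ((Finset.univ : Finset Θ) \ H)) := ⟨F, rfl⟩
  rw [ballooningExtension, dif_pos h]
  congr 1
  rw [← image_fst_balloon_inter hH h.choose, ← h.choose_spec, image_fst_balloon_inter hH]

lemma marginalization_conjComb_categorical {Ω Θ : Type*} [Fintype Ω] [DecidableEq Ω]
    [Fintype Θ] [DecidableEq Θ] (H : Finset Θ) (M : Finset (Ω × Θ) → ℝ) (F : Finset Ω) :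
    marginalization (conjComb M (categorical H)) F =
      ∑ G : Finset (Ω × Θ),
        if (G ∩ ((Finset.univ : Finset Ω) ×ˢ H)).image Prod.fst = F then M G else 0 := by
  simp only [marginalization, conjComb, sum_filter (s := (univ : Finset (Finset (Ω × Θ) × Finset (Ω × Θ))))]
  rw [sum_comm, Fintype.sum_prod_type]
  refine sum_congr rfl fun G _ => ?_
  simp only [categorical, sum_ite_eq, mem_filter, mem_univ, true_and, mul_ite, mul_one, mul_zero]
  rw [sum_eq_single (univ ×ˢ H)] <;> simp +contextual

/-- Conditioning (conjunctive combination with the categorical mass function on `Ω × H`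
followed by marginalization onto `Ω`) inverts the ballooning extension. -/
theorem conditioning_ballooningExtension {Ω Θ : Type*} [Fintype Ω] [DecidableEq Ω]
    [Fintype Θ] [DecidableEq Θ] (H : Finset Θ) (hH : H.Nonempty)
    (m₀ : Finset Ω → ℝ) (hm₀ : ∀ F, 0 ≤ m₀ F) (hm₀1 : ∑ F : Finset Ω, m₀ F = 1) :
    ∀ F : Finset Ω,
      marginalization (conjComb (ballooningExtension H m₀) (categorical H)) F = m₀ F := by
  intro F
  rw [marginalization_conjComb_categorical, sum_eq_single
    ((F ×ˢ H) ∪ ((Finset.univ : Finset Ω) ×ˢ ((Finset.univ : Finset Θ) \ H)))]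
  · rw [if_pos (image_fst_balloon_inter hH F), ballooningExtension_balloon hH]
  · intro G _ hG
    split_ifs with h
    · refine dif_neg ?_
      rintro ⟨F', rfl⟩
      rw [image_fst_balloon_inter hH] at h
      exact hG (by rw [h])
    · rfl
  · simp
end
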